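/- arXiv:1904.00752 — 2 statements merged into one kernel-verified Lean document; each statement's English description precedes it below -/
import Mathlib

section
/- Let a, b > 0 and let U be distributed according to the Haar probability measure on SU(2). Then the pushforward of Haar measure under the map U ↦ (largest eigenvalue of the Hermitian matrix diag(a, −a) + U·diag(b, −b)·U*) equals the measure on ℝ with density t/(2ab) on the interval [|a − b|, a + b] and 0 elsewhere, with respect to Lebesgue measure. (Equivalently, the volume function J for SU(2) is the indicator function of the Horn interval.) -/
open MeasureTheory Matrix Polynomial Set

noncomputable instance : MeasurableSpace (Matrix (Fin 2) (Fin 2) ℂ) := by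
  unfold Matrix; infer_instance

/-- The Hermitian matrix `diag(a, −a) + U·diag(b, −b)·U*`. -/
noncomputable def hornSum (a b : ℝ) (U : Matrix (Fin 2) (Fin 2) ℂ) : Matrix (Fin 2) (Fin 2) ℂ :=
  !![(a : ℂ), 0; 0, (-a : ℂ)] + U * !![(b : ℂ), 0; 0, (-b : ℂ)] * Uᴴ


namespace SU2Horn

abbrev M2 := Matrix (Fin 2) (Fin 2) ℂ

lemma meas_entry (i j : Fin 2) : Measurable (fun V : M2 => V i j) := by
  have h : Measurable (fun V : Fin 2 → Fin 2 → ℂ => V i j) := by fun_prop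
  exact h

lemma meas_mul (U : M2) : Measurable (fun V : M2 => U * V) := by
  have h : Measurable (fun V : M2 => (fun i j => (U * V) i j : Fin 2 → Fin 2 → ℂ)) := by
    refine measurable_pi_lambda _ fun i => measurable_pi_lambda _ fun j => ?_
    simp only [Matrix.mul_apply, Fin.sum_univ_two]
    exact ((meas_entry 0 j).const_mul _).add ((meas_entry 1 j).const_mul _)
  exact h

/-- Hopf coordinates of the first column. -/
noncomputable def hx (V : M2) : ℝ := 2 * ((V 0 0).re * (V 1 0).re + (V 0 0).im * (V 1 0).im)
noncomputable def hy (V : M2) : ℝ := 2 * ((V 0 0).im * (V 1 0).re - (V 0 0).re * (V 1 0).im)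
noncomputable def hz (V : M2) : ℝ :=
  (V 0 0).re ^ 2 + (V 0 0).im ^ 2 - (V 1 0).re ^ 2 - (V 1 0).im ^ 2

lemma meas_re (i j : Fin 2) : Measurable (fun V : M2 => (V i j).re) :=
  Complex.measurable_re.comp (meas_entry i j)
lemma meas_im (i j : Fin 2) : Measurable (fun V : M2 => (V i j).im) :=
  Complex.measurable_im.comp (meas_entry i j)

lemma meas_hx : Measurable hx := by
  have h1 := meas_re 0 0
  have h2 := meas_re 1 0
  have h3 := meas_im 0 0
  have h4 := meas_im 1 0
  unfold hx
  fun_prop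
lemma meas_hy : Measurable hy := by
  have h1 := meas_re 0 0
  have h2 := meas_re 1 0
  have h3 := meas_im 0 0
  have h4 := meas_im 1 0
  unfold hy
  fun_prop
lemma meas_hz : Measurable hz := by
  have h1 := meas_re 0 0
  have h2 := meas_re 1 0
  have h3 := meas_im 0 0
  have h4 := meas_im 1 0
  unfold hz
  fun_prop

lemma su2_form {U : M2} (hU : U ∈ Matrix.specialUnitaryGroup (Fin 2) ℂ) :
    U 1 1 = star (U 0 0) ∧ U 0 1 = - star (U 1 0) ∧
    (U 0 0).re ^ 2 + (U 0 0).im ^ 2 + (U 1 0).re ^ 2 + (U 1 0).im ^ 2 = 1 := by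
  rw [Matrix.mem_specialUnitaryGroup_iff] at hU
  obtain ⟨h1, h2⟩ := hU
  have h3 := Matrix.mem_unitaryGroup_iff.1 h1
  have h4 := Matrix.mem_unitaryGroup_iff'.1 h1
  have h5 : star U = U.adjugate := by
    calc star U = star U * (U * U.adjugate) := by rw [Matrix.mul_adjugate, h2]; simp
      _ = U.adjugate := by rw [← mul_assoc, h4, one_mul]
  have e00 : star (U 0 0) = U 1 1 := by
    have := congrFun (congrFun h5 0) 0
    simpa [Matrix.adjugate_fin_two, Matrix.star_apply] using this
  have e01 : star (U 1 0) = - U 0 1 := by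
    have := congrFun (congrFun h5 0) 1
    simpa [Matrix.adjugate_fin_two, Matrix.star_apply] using this
  have e : U 0 1 = - star (U 1 0) := by rw [e01]; ring
  refine ⟨e00.symm, e, ?_⟩
  rw [Matrix.det_fin_two, ← e00, e] at h2
  have := congrArg Complex.re h2
  simp at this
  nlinarith

lemma hxyz {U : M2} (hU : U ∈ Matrix.specialUnitaryGroup (Fin 2) ℂ) :
    hx U ^ 2 + hy U ^ 2 + hz U ^ 2 = 1 := by
  obtain ⟨-, -, h⟩ := su2_form hU
  have : hx U ^ 2 + hy U ^ 2 + hz U ^ 2 = ((U 0 0).re ^ 2 + (U 0 0).im ^ 2 + (U 1 0).re ^ 2 + (U 1 0).im ^ 2)^2 := by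
    unfold hx hy hz; ring
  rw [this, h]; norm_num

noncomputable def rot (t : ℝ) : M2 :=
  !![(Real.cos (t/2) : ℂ), (Real.sin (t/2) : ℂ); -(Real.sin (t/2) : ℂ), (Real.cos (t/2) : ℂ)]

lemma rot_mem (t : ℝ) : rot t ∈ Matrix.specialUnitaryGroup (Fin 2) ℂ := by
  have h : (Real.cos (t/2) : ℂ)^2 + (Real.sin (t/2) : ℂ)^2 = 1 := by
    exact_mod_cast Real.cos_sq_add_sin_sq (t/2)
  rw [Matrix.mem_specialUnitaryGroup_iff]
  constructor
  · rw [Matrix.mem_unitaryGroup_iff]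
    ext i j
    fin_cases i <;> fin_cases j <;>
      simp [rot, Matrix.mul_apply, Fin.sum_univ_two, Matrix.star_apply,
        -Complex.ofReal_cos, -Complex.ofReal_sin] <;> first | linear_combination h | ring
  · rw [Matrix.det_fin_two]
    simp [rot, -Complex.ofReal_cos, -Complex.ofReal_sin]
    linear_combination h

lemma hz_rot (t : ℝ) (V : M2) : hz (rot t * V) = Real.cos t * hz V + Real.sin t * hx V := by
  have e1 : Real.cos t = Real.cos (t/2)^2 - Real.sin (t/2)^2 := by
    rw [← Real.cos_two_mul']; ring_nf
  have e2 : Real.sin t = 2 * Real.sin (t/2) * Real.cos (t/2) := by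
    rw [← Real.sin_two_mul]; ring_nf
  rw [e1, e2]
  simp [hz, hx, rot, Matrix.mul_apply, Fin.sum_univ_two, -Complex.ofReal_cos, -Complex.ofReal_sin]
  ring

lemma hx_rot (t : ℝ) (V : M2) : hx (rot t * V) = Real.cos t * hx V - Real.sin t * hz V := by
  have e1 : Real.cos t = Real.cos (t/2)^2 - Real.sin (t/2)^2 := by
    rw [← Real.cos_two_mul']; ring_nf
  have e2 : Real.sin t = 2 * Real.sin (t/2) * Real.cos (t/2) := by
    rw [← Real.sin_two_mul]; ring_nf
  rw [e1, e2]
  simp [hz, hx, rot, Matrix.mul_apply, Fin.sum_univ_two, -Complex.ofReal_cos, -Complex.ofReal_sin]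
  ring

noncomputable def dg : M2 := !![⟨√2/2, √2/2⟩, 0; 0, ⟨√2/2, -(√2/2)⟩]

lemma dg_mem : dg ∈ Matrix.specialUnitaryGroup (Fin 2) ℂ := by
  have h : (√2/2) * (√2/2) = 1/2 := by
    have := Real.mul_self_sqrt (show (0:ℝ) ≤ 2 by norm_num)
    linarith
  rw [Matrix.mem_specialUnitaryGroup_iff]
  constructor
  · rw [Matrix.mem_unitaryGroup_iff]
    ext i j
    fin_cases i <;> fin_cases j <;>
      simp [dg, Matrix.mul_apply, Fin.sum_univ_two, Matrix.star_apply, Complex.ext_iff] <;>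
      linarith
  · rw [Matrix.det_fin_two]
    simp [dg, Complex.ext_iff]
    linarith

lemma hz_dg (V : M2) : hz (dg * V) = hz V := by
  have h : √2^2 = 2 := Real.sq_sqrt (by norm_num)
  simp [hz, dg, Matrix.mul_apply, Fin.sum_univ_two]
  ring_nf
  rw [h]; ring

lemma hx_dg (V : M2) : hx (dg * V) = - hy V := by
  have h : √2^2 = 2 := Real.sq_sqrt (by norm_num)
  simp [hx, hy, dg, Matrix.mul_apply, Fin.sum_univ_two]
  ring_nf
  rw [h]; ring

section
variable (ν : Measure M2) [IsProbabilityMeasure ν]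

lemma int_inv (hinv : ∀ U ∈ Matrix.specialUnitaryGroup (Fin 2) ℂ,
      Measure.map (fun V => U * V) ν = ν) (U : M2)
    (hU : U ∈ Matrix.specialUnitaryGroup (Fin 2) ℂ) (F : M2 → ℝ) (hF : Measurable F) :
    ∫ V, F (U * V) ∂ν = ∫ V, F V ∂ν := by
  conv_rhs => rw [← hinv U hU]
  rw [integral_map (meas_mul U).aemeasurable hF.aestronglyMeasurable]

lemma bound (hsupp : ν {U | U ∈ Matrix.specialUnitaryGroup (Fin 2) ℂ}ᶜ = 0) :
    ∀ᵐ V ∂ν, V ∈ Matrix.specialUnitaryGroup (Fin 2) ℂ := by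
  rw [ae_iff]; exact hsupp

lemma deriv_id (hsupp : ν {U | U ∈ Matrix.specialUnitaryGroup (Fin 2) ℂ}ᶜ = 0)
    (hinv : ∀ U ∈ Matrix.specialUnitaryGroup (Fin 2) ℂ,
      Measure.map (fun V => U * V) ν = ν) (k : ℕ) :
    ∫ V, (k * hz V ^ (k-1) * hx V ^ 2 - hz V ^ (k+1)) ∂ν = 0 := by
  have mx := meas_hx
  have mz := meas_hz
  set F : ℝ → M2 → ℝ := fun t V =>
    (Real.cos t * hx V - Real.sin t * hz V) * (Real.cos t * hz V + Real.sin t * hx V) ^ k with hF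
  set F' : ℝ → M2 → ℝ := fun t V =>
    k * (Real.cos t * hz V + Real.sin t * hx V) ^ (k-1) * (Real.cos t * hx V - Real.sin t * hz V)^2
      - (Real.cos t * hz V + Real.sin t * hx V) ^ (k+1) with hF'
  have hc : ∀ t, ∫ V, F t V ∂ν = ∫ V, hx V * hz V ^ k ∂ν := by
    intro t
    rw [← int_inv ν hinv (rot t) (rot_mem t) (fun V => hx V * hz V ^ k) (by fun_prop)]
    simp only [hF, hx_rot, hz_rot]
  have hb : ∀ᵐ V ∂ν, ∀ t, |Real.cos t * hz V + Real.sin t * hx V| ≤ 1 ∧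
      |Real.cos t * hx V - Real.sin t * hz V| ≤ 1 := by
    filter_upwards [bound ν hsupp] with V hV t
    have h1 := hxyz hV
    have h2 := Real.sin_sq_add_cos_sq t
    have h3 : (Real.cos t * hz V + Real.sin t * hx V)^2 + (Real.cos t * hx V - Real.sin t * hz V)^2
      = hx V ^2 + hz V ^2 := by
      linear_combination (hx V ^2 + hz V ^2) * h2
    constructor
    · rw [← sq_le_one_iff_abs_le_one]
      nlinarith [sq_nonneg (hy V), sq_nonneg (Real.cos t * hx V - Real.sin t * hz V)]
    · rw [← sq_le_one_iff_abs_le_one]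
      nlinarith [sq_nonneg (hy V), sq_nonneg (Real.cos t * hz V + Real.sin t * hx V)]
  have key := hasDerivAt_integral_of_dominated_loc_of_deriv_le (μ := ν) (F := F) (F' := F')
    (x₀ := (0:ℝ)) (s := Set.univ) (bound := fun _ => (k:ℝ) + 1) Filter.univ_mem
    (Filter.Eventually.of_forall fun t => by
      apply Measurable.aestronglyMeasurable; simp only [hF]; fun_prop)
    (by
      refine Integrable.of_bound (C := 1) ?_ ?_
      · apply Measurable.aestronglyMeasurable; simp only [hF]; fun_prop
      · filter_upwards [hb] with V hV
        simp only [hF, Real.norm_eq_abs, abs_mul, abs_pow]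
        exact mul_le_one₀ (hV 0).2 (by positivity) (pow_le_one₀ (abs_nonneg _) (hV 0).1))
    (by apply Measurable.aestronglyMeasurable; simp only [hF']; fun_prop)
    (by
      filter_upwards [hb] with V hV t _
      simp only [hF', Real.norm_eq_abs]
      refine (abs_sub _ _).trans ?_
      simp only [abs_mul, abs_pow, Nat.abs_cast]
      refine add_le_add ?_ (pow_le_one₀ (abs_nonneg _) (hV t).1)
      rw [mul_assoc]
      refine mul_le_of_le_one_right (by positivity) ?_
      exact mul_le_one₀ (pow_le_one₀ (abs_nonneg _) (hV t).1) (by positivity)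
        (pow_le_one₀ (abs_nonneg _) (hV t).2))
    (integrable_const _)
    (Filter.Eventually.of_forall fun V t _ => by
      have a1 : HasDerivAt (fun t => Real.cos t * hx V - Real.sin t * hz V)
        (-Real.sin t * hx V - Real.cos t * hz V) t :=
        ((Real.hasDerivAt_cos t).mul_const _).sub ((Real.hasDerivAt_sin t).mul_const _)
      have a2 : HasDerivAt (fun t => Real.cos t * hz V + Real.sin t * hx V)
        (-Real.sin t * hz V + Real.cos t * hx V) t :=
        ((Real.hasDerivAt_cos t).mul_const _).add ((Real.hasDerivAt_sin t).mul_const _)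
      have a3 := a1.mul (a2.pow k)
      refine a3.congr_deriv ?_
      simp only [hF', Pi.pow_apply]
      ring)
  have h2 := key.2
  simp only [hc] at h2
  have h3 := h2.unique (hasDerivAt_const _ _)
  simpa [hF'] using h3

lemma integ (hsupp : ν {U | U ∈ Matrix.specialUnitaryGroup (Fin 2) ℂ}ᶜ = 0) (k m l : ℕ) :
    Integrable (fun V => hz V ^ k * hx V ^ m * hy V ^ l) ν := by
  have mx := meas_hx
  have mz := meas_hz
  have my := meas_hy
  refine Integrable.of_bound (C := 1) (by apply Measurable.aestronglyMeasurable; fun_prop) ?_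
  filter_upwards [bound ν hsupp] with V hV
  have h := hxyz hV
  have h1 : |hx V| ≤ 1 := by
    rw [← sq_le_one_iff_abs_le_one]; nlinarith [sq_nonneg (hy V), sq_nonneg (hz V)]
  have h2 : |hy V| ≤ 1 := by
    rw [← sq_le_one_iff_abs_le_one]; nlinarith [sq_nonneg (hx V), sq_nonneg (hz V)]
  have h3 : |hz V| ≤ 1 := by
    rw [← sq_le_one_iff_abs_le_one]; nlinarith [sq_nonneg (hx V), sq_nonneg (hy V)]
  simp only [Real.norm_eq_abs, abs_mul, abs_pow]
  exact mul_le_one₀ (mul_le_one₀ (pow_le_one₀ (abs_nonneg _) h3) (by positivity)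
    (pow_le_one₀ (abs_nonneg _) h1)) (by positivity) (pow_le_one₀ (abs_nonneg _) h2)

lemma moment_rec (hsupp : ν {U | U ∈ Matrix.specialUnitaryGroup (Fin 2) ℂ}ᶜ = 0)
    (hinv : ∀ U ∈ Matrix.specialUnitaryGroup (Fin 2) ℂ,
      Measure.map (fun V => U * V) ν = ν) (j : ℕ) :
    ((j:ℝ)+3) * ∫ V, hz V ^ (j+2) ∂ν = ((j:ℝ)+1) * ∫ V, hz V ^ j ∂ν := by
  have mx := meas_hx
  have mz := meas_hz
  have i0 : ∀ j, Integrable (fun V => hz V ^ j) ν := fun j => by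
    simpa using integ ν hsupp j 0 0
  have i1 : Integrable (fun V => hz V ^ j * hx V ^ 2) ν := by
    simpa using integ ν hsupp j 2 0
  have i2 : Integrable (fun V => hz V ^ j * hy V ^ 2) ν := by
    simpa using integ ν hsupp j 0 2
  have h1 := deriv_id ν hsupp hinv (j+1)
  have h2 : ∫ V, hz V ^ j * hy V ^ 2 ∂ν = ∫ V, hz V ^ j * hx V ^ 2 ∂ν := by
    rw [← int_inv ν hinv dg dg_mem (fun V => hz V ^ j * hx V ^ 2) (by fun_prop)]
    simp only [hx_dg, hz_dg, neg_sq]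
  have h3 : ∫ V, hz V ^ j ∂ν = ∫ V, (hz V ^ j * hx V ^ 2 + hz V ^ j * hy V ^ 2 + hz V ^ (j+2)) ∂ν := by
    apply integral_congr_ae
    filter_upwards [bound ν hsupp] with V hV
    linear_combination (- hz V ^ j) * hxyz hV
  have i12 : Integrable (fun V => hz V ^ j * hx V ^ 2 + hz V ^ j * hy V ^ 2) ν := i1.add i2
  rw [integral_add i12 (i0 _), integral_add i1 i2, h2] at h3
  simp only [Nat.add_sub_cancel, mul_assoc] at h1
  rw [integral_sub (i1.const_mul _) (i0 _), integral_const_mul] at h1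
  push_cast at h1
  have : j + 1 + 1 = j + 2 := rfl
  rw [this] at h1
  linear_combination (-2) * h1 - ((j:ℝ)+1) * h3

lemma moment (hsupp : ν {U | U ∈ Matrix.specialUnitaryGroup (Fin 2) ℂ}ᶜ = 0)
    (hinv : ∀ U ∈ Matrix.specialUnitaryGroup (Fin 2) ℂ,
      Measure.map (fun V => U * V) ν = ν) (n : ℕ) :
    ∫ V, hz V ^ n ∂ν = (1/2) * ∫ t in (-1:ℝ)..1, t ^ n := by
  induction n using Nat.twoStepInduction with
  | zero => simp; norm_num
  | one =>
    have := deriv_id ν hsupp hinv 0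
    simp [integral_neg] at this
    simp [this]
  | more j ih _ =>
    have h := moment_rec ν hsupp hinv j
    rw [ih] at h
    rw [integral_pow] at h ⊢
    have p1 : (j:ℝ)+3 ≠ 0 := by positivity
    have p2 : (j:ℝ)+1 ≠ 0 := by positivity
    apply mul_left_cancel₀ p1
    rw [h]
    push_cast
    have p3 : (j:ℝ)+2+1 ≠ 0 := by positivity
    field_simp
    ring

lemma poly_moment (hsupp : ν {U | U ∈ Matrix.specialUnitaryGroup (Fin 2) ℂ}ᶜ = 0)
    (hinv : ∀ U ∈ Matrix.specialUnitaryGroup (Fin 2) ℂ,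
      Measure.map (fun V => U * V) ν = ν) (p : Polynomial ℝ) :
    Integrable (fun V => p.eval (hz V)) ν ∧
    ∫ V, p.eval (hz V) ∂ν = (1/2) * ∫ t in (-1:ℝ)..1, p.eval t := by
  have i0 : ∀ j, Integrable (fun V => hz V ^ j) ν := fun j => by
    simpa using integ ν hsupp j 0 0
  induction p using Polynomial.induction_on' with
  | add p q hp hq =>
    simp only [Polynomial.eval_add]
    refine ⟨hp.1.add hq.1, ?_⟩
    rw [integral_add hp.1 hq.1, intervalIntegral.integral_add, hp.2, hq.2]
    · ring
    · exact p.continuous.intervalIntegrable _ _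
    · exact q.continuous.intervalIntegrable _ _
  | monomial n c =>
    simp only [Polynomial.eval_monomial]
    refine ⟨(i0 n).const_mul _, ?_⟩
    rw [integral_const_mul, intervalIntegral.integral_const_mul, moment ν hsupp hinv n]
    ring

lemma cont_moment (hsupp : ν {U | U ∈ Matrix.specialUnitaryGroup (Fin 2) ℂ}ᶜ = 0)
    (hinv : ∀ U ∈ Matrix.specialUnitaryGroup (Fin 2) ℂ,
      Measure.map (fun V => U * V) ν = ν) (g : ℝ → ℝ) (hg : Continuous g) :
    ∫ V, g (hz V) ∂ν = (1/2) * ∫ t in (-1:ℝ)..1, g t := by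
  have mz := meas_hz
  have hz1 : ∀ᵐ V ∂ν, hz V ∈ Set.Icc (-1:ℝ) 1 := by
    filter_upwards [bound ν hsupp] with V hV
    have h := hxyz hV
    rw [Set.mem_Icc, ← abs_le, ← sq_le_one_iff_abs_le_one]
    nlinarith [sq_nonneg (hx V), sq_nonneg (hy V)]
  have ig : Integrable (fun V => g (hz V)) ν := by
    obtain ⟨C, hC⟩ := isCompact_Icc.exists_bound_of_continuousOn (hg.continuousOn (s := Set.Icc (-1:ℝ) 1))
    refine Integrable.of_bound (C := C) (hg.measurable.comp mz).aestronglyMeasurable ?_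
    filter_upwards [hz1] with V hV using hC _ hV
  apply eq_of_abs_sub_le_all
  intro ε hε
  obtain ⟨p, hp⟩ := exists_polynomial_near_of_continuousOn (-1) 1 g hg.continuousOn (ε/2) (by positivity)
  obtain ⟨ip, ep⟩ := poly_moment ν hsupp hinv p
  have e1 : |∫ V, g (hz V) ∂ν - ∫ V, p.eval (hz V) ∂ν| ≤ ε/2 := by
    rw [← integral_sub ig ip]
    have := norm_integral_le_of_norm_le_const (μ := ν) (f := fun V => g (hz V) - p.eval (hz V)) (C := ε/2) (by
      filter_upwards [hz1] with V hV
      rw [Real.norm_eq_abs, abs_sub_comm]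
      exact (hp _ hV).le)
    simpa using this
  have e2 : |(∫ t in (-1:ℝ)..1, p.eval t) - ∫ t in (-1:ℝ)..1, g t| ≤ ε := by
    rw [← intervalIntegral.integral_sub (p.continuous.intervalIntegrable _ _) (hg.intervalIntegrable _ _)]
    have := intervalIntegral.norm_integral_le_of_norm_le_const (a := (-1:ℝ)) (b := 1)
      (f := fun t => p.eval t - g t) (C := ε/2) (by
      intro t ht
      rw [Set.uIoc_of_le (by norm_num)] at ht
      exact (hp _ ⟨ht.1.le, ht.2⟩).le)
    rw [Real.norm_eq_abs] at this
    refine this.trans ?_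
    norm_num
  rw [ep] at e1
  rw [abs_le] at *
  constructor <;> linarith [e1.1, e1.2, e2.1, e2.2]

end

lemma f_eq (a b : ℝ) (U : M2) (hU : U ∈ Matrix.specialUnitaryGroup (Fin 2) ℂ) (r : ℝ)
    (hr : (hornSum a b U).charpoly.IsRoot (r : ℂ) ∧
      ∀ s : ℝ, (hornSum a b U).charpoly.IsRoot ((s : ℂ)) → s ≤ r) :
    r = √(a^2 + b^2 + 2*a*b*hz U) := by
  obtain ⟨h11, h01, hn⟩ := su2_form hU
  have key : ∀ s : ℝ, (hornSum a b U).charpoly.IsRoot (s : ℂ) ↔ s^2 = a^2 + b^2 + 2*a*b*hz U := by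
    intro s
    have : (hornSum a b U).charpoly.eval (s:ℂ) = ((s^2 - (a^2 + b^2 + 2*a*b*hz U) : ℝ) : ℂ) := by
      rw [Matrix.charpoly_fin_two, Matrix.trace_fin_two, Matrix.det_fin_two]
      simp only [hornSum, Matrix.add_apply, Matrix.mul_apply, Fin.sum_univ_two,
        Matrix.conjTranspose_apply, h11, h01]
      have e0 : (U 0 0) = (U 0 0).re + (U 0 0).im * Complex.I := (Complex.re_add_im _).symm
      have e1 : (U 1 0) = (U 1 0).re + (U 1 0).im * Complex.I := (Complex.re_add_im _).symm
      unfold hz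
      generalize (U 0 0).re = p at *
      generalize (U 0 0).im = q at *
      generalize (U 1 0).re = u at *
      generalize (U 1 0).im = v at *
      have hn' : (p:ℂ)^2+q^2+u^2+v^2 = 1 := by exact_mod_cast hn
      rw [e0, e1]
      simp
      have hI := Complex.I_sq
      ring_nf
      simp only [hI, show Complex.I^4 = 1 by rw [show Complex.I^4 = (Complex.I^2)^2 by ring, hI]; norm_num]
      linear_combination (-b^2 * ((p:ℂ)^2+q^2+u^2+v^2 + 1)) * hn'
    rw [Polynomial.IsRoot, this]
    norm_cast
    rw [sub_eq_zero]
  have h1 := (key r).1 hr.1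
  have h2 := hr.2 (-r) ((key _).2 (by rw [← h1]; ring))
  rw [← h1, Real.sqrt_sq (by linarith)]

end SU2Horn

/-- For `a, b > 0` and `U` distributed according to the Haar probability measure
on `SU(2)` (formalized as a left-invariant probability measure supported on `SU(2)`), the
pushforward of Haar measure under `U ↦ (largest eigenvalue of diag(a,−a) + U·diag(b,−b)·U*)`
has density `t/(2ab)` on `[|a − b|, a + b]` and `0` elsewhere, w.r.t. Lebesgue measure. -/
theorem su2_horn_pushforward (a b : ℝ) (ha : 0 < a) (hb : 0 < b)
    (ν : Measure (Matrix (Fin 2) (Fin 2) ℂ)) [IsProbabilityMeasure ν]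
    (hsupp : ν {U | U ∈ Matrix.specialUnitaryGroup (Fin 2) ℂ}ᶜ = 0)
    (hinv : ∀ U ∈ Matrix.specialUnitaryGroup (Fin 2) ℂ,
      Measure.map (fun V => U * V) ν = ν)
    (f : Matrix (Fin 2) (Fin 2) ℂ → ℝ) (hf : Measurable f)
    (hmax : ∀ U ∈ Matrix.specialUnitaryGroup (Fin 2) ℂ,
      (hornSum a b U).charpoly.IsRoot ((f U : ℂ)) ∧
      ∀ s : ℝ, (hornSum a b U).charpoly.IsRoot ((s : ℂ)) → s ≤ f U) :
    Measure.map f ν = volume.withDensity (fun t : ℝ =>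
      if t ∈ Set.Icc |a - b| (a + b) then ENNReal.ofReal (t / (2 * a * b)) else 0) := by
  have hab : 0 < 2 * a * b := by positivity
  have hle : |a - b| ≤ a + b := by rw [abs_le]; constructor <;> linarith
  set d : ℝ → ℝ := fun t => (Set.Icc |a - b| (a + b)).indicator (fun t => t / (2*a*b)) t with hd
  have hd0 : ∀ t, 0 ≤ d t := fun t => by
    refine Set.indicator_nonneg (fun t ht => ?_) t
    exact div_nonneg ((abs_nonneg _).trans ht.1) hab.le
  have hdm : Measurable d := by
    apply Measurable.indicator _ measurableSet_Icc
    fun_prop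
  have hdi : Integrable d := by
    rw [hd]
    apply IntegrableOn.integrable_indicator _ measurableSet_Icc
    apply Continuous.integrableOn_Icc
    fun_prop
  have hde : (fun t : ℝ => if t ∈ Set.Icc |a - b| (a + b) then ENNReal.ofReal (t / (2 * a * b)) else 0)
      = fun t => ENNReal.ofReal (d t) := by
    funext t
    by_cases h : t ∈ Set.Icc |a - b| (a + b)
    · simp only [hd, if_pos h, Set.indicator_of_mem h]
    · simp only [hd, if_neg h, Set.indicator_of_notMem h, ENNReal.ofReal_zero]
  rw [hde]
  have : IsFiniteMeasure (volume.withDensity (fun t => ENNReal.ofReal (d t))) :=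
    isFiniteMeasure_withDensity_ofReal hdi.2
  have : IsFiniteMeasure (Measure.map f ν) := inferInstance
  apply ext_of_forall_integral_eq_of_IsFiniteMeasure
  intro g
  rw [integral_map hf.aemeasurable g.continuous.measurable.aestronglyMeasurable]
  have e1 : ∫ x, g (f x) ∂ν = ∫ x, g (√(a^2 + b^2 + 2*a*b*SU2Horn.hz x)) ∂ν := by
    apply integral_congr_ae
    filter_upwards [SU2Horn.bound ν hsupp] with V hV
    rw [SU2Horn.f_eq a b V hV (f V) (hmax V hV)]
  have hG : Continuous (fun t : ℝ => g (√(a^2 + b^2 + 2*a*b*t))) := by fun_prop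
  rw [e1, SU2Horn.cont_moment ν hsupp hinv _ hG]
  rw [integral_withDensity_eq_integral_toReal_smul (by fun_prop) (by simp)]
  have e2 : ∀ t, (ENNReal.ofReal (d t)).toReal • g t =
      (Set.Icc |a - b| (a + b)).indicator (fun t => t / (2*a*b) * g t) t := by
    intro t
    rw [ENNReal.toReal_ofReal (hd0 t), smul_eq_mul]
    by_cases h : t ∈ Set.Icc |a - b| (a + b)
    · simp only [hd, Set.indicator_of_mem h]
    · simp only [hd, Set.indicator_of_notMem h, zero_mul]
  simp only [e2]
  rw [integral_indicator measurableSet_Icc, integral_Icc_eq_integral_Ioc,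
    ← intervalIntegral.integral_of_le hle]
  have sub := intervalIntegral.integral_comp_mul_deriv (a := |a-b|) (b := a+b)
    (f := fun t : ℝ => (t^2 - a^2 - b^2)/(2*a*b)) (f' := fun t => t/(a*b))
    (g := fun t : ℝ => g (√(a^2 + b^2 + 2*a*b*t)))
    (by
      intro t _
      have := (((hasDerivAt_pow 2 t).sub_const (a^2)).sub_const (b^2)).div_const (2*a*b)
      refine this.congr_deriv ?_
      push_cast
      field_simp
      try simp)
    (by fun_prop) hG
  have b1 : (|a-b|^2 - a^2 - b^2)/(2*a*b) = -1 := by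
    rw [sq_abs]; field_simp; ring
  have b2 : ((a+b)^2 - a^2 - b^2)/(2*a*b) = 1 := by
    field_simp; ring
  simp only [b1, b2] at sub
  rw [← sub, ← intervalIntegral.integral_const_mul]
  apply intervalIntegral.integral_congr
  intro t ht
  rw [Set.uIcc_of_le hle] at ht
  have ht0 : 0 ≤ t := (abs_nonneg _).trans ht.1
  have e3 : a^2 + b^2 + 2*a*b*((t^2 - a^2 - b^2)/(2*a*b)) = t^2 := by
    field_simp; ring
  simp only [Function.comp, e3, Real.sqrt_sq ht0]
  field_simp
end

section
/- Let A and B be 5×5 real skew-symmetric matrices and C = A + B. Suppose α₁ ≥ α₂ ≥ 0, β₁ ≥ β₂ ≥ 0, γ₁ ≥ γ₂ ≥ 0 are real numbers such that the complex Hermitian matrices i·A, i·B, i·C have eigenvalue multisets {α₁, α₂, 0, −α₂, −α₁}, {β₁, β₂, 0, −β₂, −β₁}, {γ₁, γ₂, 0, −γ₂, −γ₁} respectively. Then the following B₂-type Horn inequalities hold: max(|α₁−β₁|, |α₂−β₂|) ≤ γ₁ ≤ α₁+β₁; max(0, α₂−β₁, β₂−α₁) ≤ γ₂ ≤ min(α₁+β₂,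 α₂+β₁); |α₁−β₁| + |α₂−β₂| ≤ γ₁+γ₂ ≤ α₁+α₂+β₁+β₂; and max(0, α₁−α₂−β₁−β₂, β₁−β₂−α₁−α₂) ≤ γ₁−γ₂ ≤ α₁+β₁−|α₂−β₂|. -/
open Matrix Polynomial

/-- The Hermitian matrix `i·A` associated with a real skew-symmetric matrix `A`. -/
noncomputable def iMat (A : Matrix (Fin 5) (Fin 5) ℝ) : Matrix (Fin 5) (Fin 5) ℂ :=
  Complex.I • (A.map (Complex.ofReal))

section Helpers
open scoped ComplexOrder

def Diag {n : ℕ} (M : Matrix (Fin n) (Fin n) ℂ) (a : Fin n → ℝ) : Prop :=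
  ∃ U : Matrix (Fin n) (Fin n) ℂ, Uᴴ * U = 1 ∧ U * Uᴴ = 1 ∧
    M = U * diagonal (fun i => (a i : ℂ)) * Uᴴ

lemma Diag.perm {n : ℕ} {M : Matrix (Fin n) (Fin n) ℂ} {a : Fin n → ℝ} (h : Diag M a)
    (σ : Equiv.Perm (Fin n)) : Diag M (a ∘ σ) := by
  obtain ⟨U, h1, h2, h3⟩ := h
  have e : (U.submatrix id σ)ᴴ = Uᴴ.submatrix σ id := by ext; simp
  refine ⟨U.submatrix id σ, ?_, ?_, ?_⟩
  · have := submatrix_mul_equiv Uᴴ U σ (Equiv.refl _) σ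
    simp only [Equiv.coe_refl] at this
    rw [e, this, h1]; simp
  · rw [e, submatrix_mul_equiv U Uᴴ id σ id, h2]; simp
  · have : diagonal (fun i => ((a ∘ σ) i : ℂ)) = (diagonal (fun i => (a i : ℂ))).submatrix σ σ := by
      ext i j; simp [diagonal_apply]
    rw [e, this, submatrix_mul_equiv, submatrix_mul_equiv, h3]; simp

lemma diag_eig {n : ℕ} {M : Matrix (Fin n) (Fin n) ℂ} (hM : M.IsHermitian) :
    Diag M hM.eigenvalues := by
  refine ⟨hM.eigenvectorUnitary, ?_, ?_, ?_⟩
  · exact Unitary.coe_star_mul_self _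
  · exact Unitary.coe_mul_star_self _
  · exact hM.spectral_theorem

lemma diag_exists {n : ℕ} {M : Matrix (Fin n) (Fin n) ℂ} (hM : M.IsHermitian) :
    ∃ a, Antitone a ∧ Diag M a := by
  refine ⟨_, ?_, (diag_eig hM).perm (Tuple.sort (fun i => - hM.eigenvalues i))⟩
  intro i j hij
  have := Tuple.monotone_sort (fun i => - hM.eigenvalues i) hij
  simpa using this

lemma diag_charpoly {n : ℕ} {M : Matrix (Fin n) (Fin n) ℂ} (hM : M.IsHermitian) (a : Fin n → ℝ)
    (ha : Antitone a) (h : M.charpoly = ∏ i, (X - C (a i : ℂ))) : Diag M a := by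
  have h1 := hM.roots_charpoly_eq_eigenvalues
  rw [h, Polynomial.roots_prod _ _
    (by simp [Finset.prod_ne_zero_iff, Polynomial.X_sub_C_ne_zero])] at h1
  have h2 : (List.ofFn a).Perm (List.ofFn hM.eigenvalues) := by
    have := congrArg (Multiset.map Complex.re) h1
    simpa [Function.comp_def] using this
  set σ := Tuple.sort (fun i => - hM.eigenvalues i)
  have hs : Antitone (hM.eigenvalues ∘ σ) := by
    intro i j hij
    have := Tuple.monotone_sort (fun i => - hM.eigenvalues i) hij
    simpa using this
  have h3 := h2.trans (Equiv.Perm.ofFn_comp_perm σ hM.eigenvalues).symm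
  have h4 := h3.eq_of_sortedGE ha.sortedGE_ofFn hs.sortedGE_ofFn
  rw [List.ofFn_inj.mp h4]
  exact (diag_eig hM).perm σ

lemma Diag.herm {n : ℕ} {M : Matrix (Fin n) (Fin n) ℂ} {a : Fin n → ℝ} (h : Diag M a) :
    M.IsHermitian := by
  obtain ⟨U, h1, h2, rfl⟩ := h
  have : (diagonal (fun i => (a i : ℂ)))ᴴ = diagonal (fun i => (a i : ℂ)) := by
    rw [diagonal_conjTranspose]; congr 1; ext; simp
  simp [Matrix.IsHermitian, conjTranspose_mul, this, mul_assoc]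

lemma Diag.trace {n : ℕ} {M : Matrix (Fin n) (Fin n) ℂ} {a : Fin n → ℝ} (h : Diag M a) :
    M.trace = ((∑ i, a i : ℝ) : ℂ) := by
  obtain ⟨U, h1, h2, rfl⟩ := h
  rw [trace_mul_comm, ← mul_assoc, h1]
  simp [Matrix.trace]

lemma Diag.shift {n : ℕ} {M : Matrix (Fin n) (Fin n) ℂ} {a : Fin n → ℝ} (h : Diag M a) (t : ℝ) :
    Diag (M + (t : ℂ) • (1 : Matrix (Fin n) (Fin n) ℂ)) (fun i => a i + t) := by
  obtain ⟨U, h1, h2, rfl⟩ := h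
  refine ⟨U, h1, h2, ?_⟩
  have : diagonal (fun i => ((a i + t : ℝ) : ℂ)) = diagonal (fun i => (a i : ℂ)) + (t : ℂ) • 1 := by
    ext i j; by_cases hh : i = j <;> simp [hh, diagonal_apply, one_apply]
  rw [this, mul_add, add_mul]; simp [h2]

lemma posSemidef_conj {n : ℕ} (U : Matrix (Fin n) (Fin n) ℂ) (a : Fin n → ℝ) (ha : ∀ i, 0 ≤ a i) :
    (U * diagonal (fun i => (a i : ℂ)) * Uᴴ).PosSemidef := by
  apply PosSemidef.mul_mul_conjTranspose_same
  exact PosSemidef.diagonal (fun i => by simpa using ha i)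

lemma quad {n : ℕ} (U : Matrix (Fin n) (Fin n) ℂ) (a : Fin n → ℝ) (x : Fin n → ℂ) :
    star x ⬝ᵥ ((U * diagonal (fun i => (a i : ℂ)) * Uᴴ) *ᵥ x)
      = ((∑ i, a i * Complex.normSq ((Uᴴ *ᵥ x) i) : ℝ) : ℂ) := by
  have h : star x ᵥ* U = star (Uᴴ *ᵥ x) := by
    rw [star_mulVec, conjTranspose_conjTranspose]
  rw [← mulVec_mulVec, ← mulVec_mulVec, dotProduct_mulVec, h]
  simp only [dotProduct, mulVec_diagonal, Pi.star_apply, Complex.ofReal_sum, Complex.ofReal_mul,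
    Complex.normSq_eq_conj_mul_self]
  refine Finset.sum_congr rfl fun i _ => ?_
  simp only [RCLike.star_def]
  ring

lemma Diag.mono {n : ℕ} {M N : Matrix (Fin n) (Fin n) ℂ} {a b : Fin n → ℝ} (ha : Antitone a)
    (hb : Antitone b) (hM : Diag M a) (hN : Diag N b) (h : (N - M).PosSemidef) (i : Fin n) :
    a i ≤ b i := by
  obtain ⟨U, hU1, hU2, hM⟩ := hM
  obtain ⟨V, hV1, hV2, hN⟩ := hN
  obtain ⟨x, hx0, hx⟩ : ∃ x ≠ 0, (Matrix.of (fun j => if j < i then Vᴴ j else if i < j then Uᴴ j else 0)) *ᵥ x = 0 := by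
    rw [Matrix.exists_mulVec_eq_zero_iff]
    exact det_eq_zero_of_row_eq_zero i (by simp)
  have hv : ∀ j < i, (Vᴴ *ᵥ x) j = 0 := fun j hj => by
    have := congrFun hx j
    simpa [mulVec, hj] using this
  have hu : ∀ j, i < j → (Uᴴ *ᵥ x) j = 0 := fun j hj => by
    have := congrFun hx j
    simpa [mulVec, hj, hj.not_gt] using this
  have qM := quad U a x
  have qN := quad V b x
  have q1 := quad U (fun _ => 1) x
  have q2 := quad V (fun _ => 1) x
  simp only [Complex.ofReal_one, diagonal_one, mul_one, one_mul, hU2, hV2, one_mulVec] at q1 q2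
  have hpos : 0 < ∑ j, Complex.normSq ((Uᴴ *ᵥ x) j) := by
    apply Finset.sum_pos' (fun _ _ => Complex.normSq_nonneg _)
    by_contra! hc
    apply hx0
    have : Uᴴ *ᵥ x = 0 := by
      ext j
      have := le_antisymm (hc j (Finset.mem_univ _)) (Complex.normSq_nonneg _)
      simpa using this
    rw [← one_mulVec x, ← hU2, ← mulVec_mulVec, this, mulVec_zero]
  have hnn := h.dotProduct_mulVec_nonneg x
  rw [sub_mulVec, dotProduct_sub, hM, hN, qM, qN] at hnn
  have hnn : (∑ j, a j * Complex.normSq ((Uᴴ *ᵥ x) j)) ≤ ∑ j, b j * Complex.normSq ((Vᴴ *ᵥ x) j) := by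
    rw [← Complex.ofReal_sub] at hnn
    have := Complex.zero_le_real.mp hnn
    linarith
  have he : ∑ j, Complex.normSq ((Uᴴ *ᵥ x) j) = ∑ j, Complex.normSq ((Vᴴ *ᵥ x) j) := by
    have := q1.symm.trans q2
    exact_mod_cast this
  have l1 : a i * ∑ j, Complex.normSq ((Uᴴ *ᵥ x) j) ≤ ∑ j, a j * Complex.normSq ((Uᴴ *ᵥ x) j) := by
    rw [Finset.mul_sum]
    apply Finset.sum_le_sum
    intro j _
    rcases lt_or_ge i j with hj | hj
    · simp [hu j hj]
    · exact mul_le_mul_of_nonneg_right (ha hj) (Complex.normSq_nonneg _)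
  have l2 : ∑ j, b j * Complex.normSq ((Vᴴ *ᵥ x) j) ≤ b i * ∑ j, Complex.normSq ((Vᴴ *ᵥ x) j) := by
    rw [Finset.mul_sum]
    apply Finset.sum_le_sum
    intro j _
    rcases lt_or_ge j i with hj | hj
    · simp [hv j hj]
    · exact mul_le_mul_of_nonneg_right (hb hj) (Complex.normSq_nonneg _)
  rw [← he] at l2
  exact le_of_mul_le_mul_right (l1.trans (hnn.trans l2)) hpos

lemma lidskii {n : ℕ} {M N : Matrix (Fin n) (Fin n) ℂ} {a b c : Fin n → ℝ} (ha : Antitone a)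
    (hc : Antitone c) (hM : Diag M a) (hN : Diag N b) (hS : Diag (M + N) c)
    (I : Finset (Fin n)) (t : ℝ) :
    ∑ i ∈ I, c i ≤ ∑ i ∈ I, (a i + t) + ∑ j, max (b j - t) 0 := by
  have hM' := hM.shift t
  obtain ⟨V, hV1, hV2, hN⟩ := hN
  set P := V * diagonal (fun i => ((max (b i - t) 0 : ℝ) : ℂ)) * Vᴴ with hP
  have dP : Diag P (fun i => max (b i - t) 0) := ⟨V, hV1, hV2, rfl⟩
  obtain ⟨z, hz, dz⟩ := diag_exists (hM'.herm.add dP.herm)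
  have h1 : ∀ i, a i + t ≤ z i := Diag.mono (fun i j h => by simpa using ha h) hz hM' dz (by
    simpa using posSemidef_conj V _ (fun i => le_max_right (b i - t) 0))
  have h2 : ∀ i, c i ≤ z i := Diag.mono hc hz hS dz (by
    have := posSemidef_conj V (fun i => max (b i - t) 0 + t - b i) (fun i => by
      have := le_max_left (b i - t) 0
      linarith)
    convert this using 1
    have hd : diagonal (fun i => ((max (b i - t) 0 + t - b i : ℝ) : ℂ))
      = diagonal (fun i => ((max (b i - t) 0 : ℝ) : ℂ)) + (t : ℂ) • 1 - diagonal (fun i => (b i : ℂ)) := by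
      ext i j; by_cases hh : i = j <;> simp [hh, diagonal_apply, one_apply]
    rw [hd, mul_sub, sub_mul, mul_add, add_mul, ← hP, ← hN]
    simp [hV2]
    abel)
  have tr : ∑ i, z i = ∑ i, (a i + t) + ∑ j, max (b j - t) 0 := by
    have := dz.trace
    rw [trace_add, hM'.trace, dP.trace] at this
    exact_mod_cast this.symm
  calc ∑ i ∈ I, c i ≤ ∑ i ∈ I, z i := Finset.sum_le_sum fun i _ => h2 i
    _ = ∑ i ∈ I, (a i + t) + ∑ i ∈ I, (z i - (a i + t)) := by rw [← Finset.sum_add_distrib]; simp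
    _ ≤ ∑ i ∈ I, (a i + t) + ∑ i, (z i - (a i + t)) := by
      refine add_le_add_right ?_ _
      exact Finset.sum_le_univ_sum_of_nonneg fun i => by linarith [h1 i]
    _ = _ := by rw [Finset.sum_sub_distrib, tr]; ring

lemma key {M N S : Matrix (Fin 5) (Fin 5) ℂ} (hMN : S = M + N) (hM : M.IsHermitian) (hN : N.IsHermitian)
    (a1 a2 b1 b2 c1 c2 : ℝ) 
    (hα : a1 ≥ a2 ∧ a2 ≥ 0) (hβ : b1 ≥ b2 ∧ b2 ≥ 0) (hγ : c1 ≥ c2 ∧ c2 ≥ 0)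
    (hAeig : M.charpoly
      = (X - Polynomial.C (a1 : ℂ)) * (X - Polynomial.C (a2 : ℂ)) * X
        * (X + Polynomial.C (a2 : ℂ)) * (X + Polynomial.C (a1 : ℂ)))
    (hBeig : N.charpoly
      = (X - Polynomial.C (b1 : ℂ)) * (X - Polynomial.C (b2 : ℂ)) * X
        * (X + Polynomial.C (b2 : ℂ)) * (X + Polynomial.C (b1 : ℂ)))
    (hCeig : S.charpoly
      = (X - Polynomial.C (c1 : ℂ)) * (X - Polynomial.C (c2 : ℂ)) * X
        * (X + Polynomial.C (c2 : ℂ)) * (X + Polynomial.C (c1 : ℂ))) :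
    c1 ≤ a1 + b1 ∧ c2 ≤ a2 + b1 ∧ c1 + c2 ≤ a1 + a2 + b1 + b2 ∧ c1 - c2 ≤ a1 - a2 + b1 + b2 := by
  subst hMN
  have anti : ∀ x y : ℝ, x ≥ y ∧ y ≥ 0 → Antitone ![x, y, 0, -y, -x] := by
    intro x y h
    rw [Fin.antitone_iff_succ_le]
    intro i
    fin_cases i <;> simp <;> linarith
  have dA : Diag M ![a1, a2, 0, -a2, -a1] := diag_charpoly hM _ (anti _ _ ‹_›) (by
    rw [hAeig]; simp [Fin.prod_univ_five])
  have dB : Diag N ![b1, b2, 0, -b2, -b1] := diag_charpoly hN _ (anti _ _ ‹_›) (by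
    rw [hBeig]; simp [Fin.prod_univ_five])
  have dC : Diag (M + N) ![c1, c2, 0, -c2, -c1] := diag_charpoly (hM.add hN) _ (anti _ _ ‹_›) (by
    rw [hCeig]; simp [Fin.prod_univ_five])
  have L := lidskii (anti _ _ hα) (anti _ _ hγ) dA dB dC
  have s1 : ∑ j, max ((![b1, b2, 0, -b2, -b1] : Fin 5 → ℝ) j - b1) 0 = 0 := by
    apply Finset.sum_eq_zero
    intro i _
    apply max_eq_right
    fin_cases i <;> simp <;> linarith
  have s2 : ∑ j, max ((![b1, b2, 0, -b2, -b1] : Fin 5 → ℝ) j - b2) 0 = b1 - b2 := by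
    simp only [Fin.sum_univ_five]
    simp
    rw [max_eq_left, max_eq_right, max_eq_right, max_eq_right] <;> linarith
  have L1 := L {0} b1
  have L2 := L {1} b1
  have L3 := L {0, 1} b2
  have L4 := L {0, 3} b2
  rw [s1] at L1 L2
  rw [s2] at L3 L4
  simp at L1 L2 L3 L4
  refine ⟨?_, ?_, ?_, ?_⟩ <;> linarith

lemma iMat_herm (A : Matrix (Fin 5) (Fin 5) ℝ) (hA : Aᵀ = -A) : (iMat A).IsHermitian := by
  ext i j
  have := congrFun (congrFun hA i) j
  simp only [transpose_apply, Matrix.neg_apply] at this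
  simp [iMat, this]

lemma iMat_neg (A : Matrix (Fin 5) (Fin 5) ℝ) (hA : Aᵀ = -A) :
    (iMat (-A)).charpoly = (iMat A).charpoly := by
  rw [← charpoly_transpose (iMat A)]
  congr 1
  rw [← hA]
  ext i j
  simp [iMat]

lemma iMat_add (A B : Matrix (Fin 5) (Fin 5) ℝ) : iMat (A + B) = iMat A + iMat B := by
  ext i j
  simp [iMat, mul_add]

end Helpers

/-- B₂-type Horn inequalities for sums of 5×5 real skew-symmetric matrices, whose
Hermitian counterparts `i·A, i·B, i·(A+B)` have eigenvalue multisets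
`{α₁, α₂, 0, −α₂, −α₁}`, `{β₁, β₂, 0, −β₂, −β₁}`, `{γ₁, γ₂, 0, −γ₂, −γ₁}`. -/
theorem horn_inequalities_B2 (A B : Matrix (Fin 5) (Fin 5) ℝ)
    (hA : Aᵀ = -A) (hB : Bᵀ = -B)
    (α1 α2 β1 β2 γ1 γ2 : ℝ)
    (hα : α1 ≥ α2 ∧ α2 ≥ 0) (hβ : β1 ≥ β2 ∧ β2 ≥ 0) (hγ : γ1 ≥ γ2 ∧ γ2 ≥ 0)
    (hAeig : (iMat A).charpoly
      = (X - Polynomial.C (α1 : ℂ)) * (X - Polynomial.C (α2 : ℂ)) * X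
        * (X + Polynomial.C (α2 : ℂ)) * (X + Polynomial.C (α1 : ℂ)))
    (hBeig : (iMat B).charpoly
      = (X - Polynomial.C (β1 : ℂ)) * (X - Polynomial.C (β2 : ℂ)) * X
        * (X + Polynomial.C (β2 : ℂ)) * (X + Polynomial.C (β1 : ℂ)))
    (hCeig : (iMat (A + B)).charpoly
      = (X - Polynomial.C (γ1 : ℂ)) * (X - Polynomial.C (γ2 : ℂ)) * X
        * (X + Polynomial.C (γ2 : ℂ)) * (X + Polynomial.C (γ1 : ℂ))) :
    (max |α1 - β1| |α2 - β2| ≤ γ1 ∧ γ1 ≤ α1 + β1) ∧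
    (max 0 (max (α2 - β1) (β2 - α1)) ≤ γ2 ∧ γ2 ≤ min (α1 + β2) (α2 + β1)) ∧
    (|α1 - β1| + |α2 - β2| ≤ γ1 + γ2 ∧ γ1 + γ2 ≤ α1 + α2 + β1 + β2) ∧
    (max 0 (max (α1 - α2 - β1 - β2) (β1 - β2 - α1 - α2)) ≤ γ1 - γ2 ∧
      γ1 - γ2 ≤ α1 + β1 - |α2 - β2|) := by
  have hC : (A + B)ᵀ = -(A + B) := by rw [transpose_add, hA, hB]; abel
  have hnA : (-A)ᵀ = -(-A) := by rw [transpose_neg, hA]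
  have hnB : (-B)ᵀ = -(-B) := by rw [transpose_neg, hB]
  have A' := iMat_herm _ hA
  have B' := iMat_herm _ hB
  have C' := iMat_herm _ hC
  have nA' := iMat_herm _ hnA
  have nB' := iMat_herm _ hnB
  have hnAeig := (iMat_neg A hA).trans hAeig
  have hnBeig := (iMat_neg B hB).trans hBeig
  obtain ⟨a1, a2, a3, a4⟩ := key (iMat_add A B) A' B' _ _ _ _ _ _ hα hβ hγ hAeig hBeig hCeig
  obtain ⟨b1, b2, b3, b4⟩ := key ((iMat_add A B).trans (add_comm _ _)) B' A' _ _ _ _ _ _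
    hβ hα hγ hBeig hAeig hCeig
  have eA : iMat A = iMat (A + B) + iMat (-B) := by rw [← iMat_add]; simp
  have eB : iMat B = iMat (A + B) + iMat (-A) := by rw [← iMat_add]; simp
  obtain ⟨c1, c2, c3, c4⟩ := key eA C' nB' _ _ _ _ _ _ hγ hβ hα hCeig hnBeig hAeig
  obtain ⟨d1, d2, d3, d4⟩ := key (eA.trans (add_comm _ _)) nB' C' _ _ _ _ _ _
    hβ hγ hα hnBeig hCeig hAeig
  obtain ⟨e1, e2, e3, e4⟩ := key eB C' nA' _ _ _ _ _ _ hγ hα hβ hCeig hnAeig hBeig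
  obtain ⟨f1, f2, f3, f4⟩ := key (eB.trans (add_comm _ _)) nA' C' _ _ _ _ _ _
    hα hγ hβ hnAeig hCeig hBeig
  obtain ⟨hα1, hα2⟩ := hα
  obtain ⟨hβ1, hβ2⟩ := hβ
  obtain ⟨hγ1, hγ2⟩ := hγ
  refine ⟨⟨?_, ?_⟩, ⟨?_, ?_⟩, ⟨?_, ?_⟩, ?_, ?_⟩
  · simp only [max_le_iff, abs_le]
    refine ⟨⟨?_, ?_⟩, ?_, ?_⟩ <;> linarith
  · linarith
  · simp only [max_le_iff]
    refine ⟨?_, ?_, ?_⟩ <;> linarith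
  · simp only [le_min_iff]
    constructor <;> linarith
  · rcases abs_cases (α1 - β1) with ⟨h, _⟩ | ⟨h, _⟩ <;>
      rcases abs_cases (α2 - β2) with ⟨h', _⟩ | ⟨h', _⟩ <;> rw [h, h'] <;> linarith
  · linarith
  · simp only [max_le_iff]
    refine ⟨?_, ?_, ?_⟩ <;> linarith
  · rcases abs_cases (α2 - β2) with ⟨h', _⟩ | ⟨h', _⟩ <;> rw [h'] <;> linarith
end
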